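/- Neither K₁ = ℚ(√−3) nor K₂ = ℚ(ζ₉), the 9th cyclotomic field, possesses a quadratic extension which is unramified at every prime ideal of its ring of integers not dividing 3. -/

import Mathlib

open NumberField

/-- The ring `(ℤ/4)[x]/(x^6+x^3+1)`. -/
@[ext] structure RR where
  a0 : ZMod 4
  a1 : ZMod 4
  a2 : ZMod 4
  a3 : ZMod 4
  a4 : ZMod 4
  a5 : ZMod 4

namespace RR

instance : DecidableEq RR := fun x y =>
  decidable_of_iff (x.a0 = y.a0 ∧ x.a1 = y.a1 ∧ x.a2 = y.a2 ∧ x.a3 = y.a3 ∧ x.a4 = y.a4 ∧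
    x.a5 = y.a5) RR.ext_iff.symm

def mul (x y : RR) : RR :=
  let c0 := x.a0*y.a0
  let c1 := x.a0*y.a1 + x.a1*y.a0
  let c2 := x.a0*y.a2 + x.a1*y.a1 + x.a2*y.a0
  let c3 := x.a0*y.a3 + x.a1*y.a2 + x.a2*y.a1 + x.a3*y.a0
  let c4 := x.a0*y.a4 + x.a1*y.a3 + x.a2*y.a2 + x.a3*y.a1 + x.a4*y.a0
  let c5 := x.a0*y.a5 + x.a1*y.a4 + x.a2*y.a3 + x.a3*y.a2 + x.a4*y.a1 + x.a5*y.a0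
  let c6 := x.a1*y.a5 + x.a2*y.a4 + x.a3*y.a3 + x.a4*y.a2 + x.a5*y.a1
  let c7 := x.a2*y.a5 + x.a3*y.a4 + x.a4*y.a3 + x.a5*y.a2
  let c8 := x.a3*y.a5 + x.a4*y.a4 + x.a5*y.a3
  let c9 := x.a4*y.a5 + x.a5*y.a4
  let c10 := x.a5*y.a5
  ⟨c0 - c6 + c9, c1 - c7 + c10, c2 - c8, c3 - c6, c4 - c7, c5 - c8⟩

instance : Zero RR := ⟨⟨0,0,0,0,0,0⟩⟩
instance : One RR := ⟨⟨1,0,0,0,0,0⟩⟩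
instance : Add RR := ⟨fun x y => ⟨x.a0+y.a0, x.a1+y.a1, x.a2+y.a2, x.a3+y.a3, x.a4+y.a4, x.a5+y.a5⟩⟩
instance : Neg RR := ⟨fun x => ⟨-x.a0, -x.a1, -x.a2, -x.a3, -x.a4, -x.a5⟩⟩
instance : Mul RR := ⟨mul⟩

theorem zero_def : (0 : RR) = ⟨0,0,0,0,0,0⟩ := rfl
theorem one_def : (1 : RR) = ⟨1,0,0,0,0,0⟩ := rfl
theorem add_def (x y : RR) : x + y =
  ⟨x.a0+y.a0, x.a1+y.a1, x.a2+y.a2, x.a3+y.a3, x.a4+y.a4, x.a5+y.a5⟩ := rfl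
theorem neg_def (x : RR) : -x = ⟨-x.a0, -x.a1, -x.a2, -x.a3, -x.a4, -x.a5⟩ := rfl
theorem mul_def (x y : RR) : x * y = mul x y := rfl

instance : CommRing RR where
  add_assoc x y z := by simp only [add_def, add_assoc]
  zero_add x := by simp [add_def, zero_def]
  add_zero x := by simp [add_def, zero_def]
  add_comm x y := by simp only [add_def, add_comm]
  neg_add_cancel x := by simp [add_def, neg_def, zero_def]
  mul_assoc x y z := by simp only [mul_def, mul]; ext <;> ring
  mul_comm x y := by simp only [mul_def, mul]; ext <;> ring
  one_mul x := by simp [mul_def, mul, one_def]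
  mul_one x := by simp [mul_def, mul, one_def]
  zero_mul x := by simp [mul_def, mul, zero_def]
  mul_zero x := by simp [mul_def, mul, zero_def]
  left_distrib x y z := by simp only [mul_def, mul, add_def]; ext <;> ring
  right_distrib x y z := by simp only [mul_def, mul, add_def]; ext <;> ring
  nsmul := nsmulRec
  zsmul := zsmulRec

def z : RR := ⟨0,1,0,0,0,0⟩

theorem z_root : z^6 + z^3 + 1 = 0 := by decide +kernel
theorem four : (4 : RR) = 0 := by decide +kernel

def bit (b : Bool) : ZMod 4 := if b then 1 else 0

theorem bit_surj : ∀ x : ZMod 4, ∃ b y, x = bit b + (y + y) := by decide +kernel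

theorem sq_eq (x : RR) : ∃ b0 b1 b2 b3 b4 b5 : Bool,
    x * x = ⟨bit b0, bit b1, bit b2, bit b3, bit b4, bit b5⟩ * ⟨bit b0, bit b1, bit b2, bit b3, bit b4, bit b5⟩ := by
  obtain ⟨b0, y0, h0⟩ := bit_surj x.a0
  obtain ⟨b1, y1, h1⟩ := bit_surj x.a1
  obtain ⟨b2, y2, h2⟩ := bit_surj x.a2
  obtain ⟨b3, y3, h3⟩ := bit_surj x.a3
  obtain ⟨b4, y4, h4⟩ := bit_surj x.a4
  obtain ⟨b5, y5, h5⟩ := bit_surj x.a5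
  refine ⟨b0, b1, b2, b3, b4, b5, ?_⟩
  set w : RR := ⟨bit b0, bit b1, bit b2, bit b3, bit b4, bit b5⟩ with hw
  have : x = w + (⟨y0,y1,y2,y3,y4,y5⟩ + ⟨y0,y1,y2,y3,y4,y5⟩) := by
    rw [RR.ext_iff]; exact ⟨h0, h1, h2, h3, h4, h5⟩
  rw [this]
  linear_combination (w * ⟨y0,y1,y2,y3,y4,y5⟩ + ⟨y0,y1,y2,y3,y4,y5⟩^2) * four

def pw (x : RR) (b : Bool) : RR := if b then x else 1

def el (a b c d : Bool) : RR := pw (-1) a * pw (1+z) b * pw (1+z*z) c * pw (z-1) d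

end RR

theorem exists_sqrt_gen (K L : Type) [Field K] [CharZero K] [Field L] [Algebra K L]
    (h : Module.finrank K L = 2) :
    ∃ (α : L) (a : K), α ^ 2 = algebraMap K L a ∧ ¬ IsSquare a := by
  have hnot : ¬ ∀ x : L, x ∈ Set.range (algebraMap K L) := by
    intro hs
    have : (⊥ : Subalgebra K L) = ⊤ := by
      rw [eq_top_iff]; intro x _; exact Algebra.mem_bot.mpr (hs x)
    have h1 := Subalgebra.bot_eq_top_iff_finrank_eq_one.mp this
    omega
  push Not at hnot
  obtain ⟨x, hx⟩ := hnot
  have : Module.Finite K L := Module.finite_of_finrank_pos (by omega)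
  have hli : ¬ LinearIndependent K ![1, x, x^2] := by
    intro hl
    have := hl.fintype_card_le_finrank
    simp [h] at this
  rw [Fintype.not_linearIndependent_iff] at hli
  obtain ⟨g, hg, i, hi⟩ := hli
  simp only [Fin.sum_univ_three, Matrix.cons_val_zero, Matrix.cons_val_one, Matrix.cons_val] at hg
  simp only [Algebra.smul_def] at hg
  have inj := (algebraMap K L).injective
  have h2 : g 2 ≠ 0 := by
    intro h2
    rw [h2] at hg
    by_cases h1 : g 1 = 0
    · rw [h1] at hg
      have h0 : g 0 = 0 := by
        apply inj; simpa using hg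
      fin_cases i <;> simp_all
    · apply hx
      refine ⟨- g 0 / g 1, ?_⟩
      have h1' : algebraMap K L (g 1) ≠ 0 := by simpa using h1
      simp only [map_div₀, map_neg]
      field_simp
      simp only [map_zero] at hg
      linear_combination -hg
  refine ⟨2 * algebraMap K L (g 2) * x + algebraMap K L (g 1), (g 1)^2 - 4 * g 0 * g 2, ?_, ?_⟩
  · simp only [map_sub, map_mul, map_pow, map_ofNat]
    linear_combination 4 * algebraMap K L (g 2) * hg
  · rintro ⟨r, hr⟩
    have h2' : algebraMap K L (g 2) ≠ 0 := by simpa using h2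
    have two : (2:L) ≠ 0 := by
      rw [← map_ofNat (algebraMap K L) 2]; simp
    have e : (2 * algebraMap K L (g 2) * x + algebraMap K L (g 1) - algebraMap K L r) *
       (2 * algebraMap K L (g 2) * x + algebraMap K L (g 1) + algebraMap K L r) = 0 := by
      have := congrArg (algebraMap K L) hr
      simp only [map_sub, map_mul, map_pow, map_ofNat] at this
      linear_combination 4 * algebraMap K L (g 2) * hg + this
    apply hx
    rcases mul_eq_zero.mp e with e | e
    · refine ⟨(r - g 1) / (2 * g 2), ?_⟩
      simp only [map_div₀, map_sub, map_mul, map_ofNat]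
      field_simp
      linear_combination -e
    · refine ⟨(-r - g 1) / (2 * g 2), ?_⟩
      simp only [map_div₀, map_sub, map_mul, map_ofNat, map_neg]
      field_simp
      linear_combination -e

theorem not_mem_sq_of_unram {K L : Type} [Field K] [NumberField K] [Field L] [Algebra K L]
    [NumberField L] (p : 𝓞 K) (Q : Ideal (𝓞 L))
    (h : Ideal.ramificationIdx' (Ideal.span {p}) Q = 1) : algebraMap (𝓞 K) (𝓞 L) p ∉ Q ^ 2 := by
  intro hp
  have hmem : 2 ∈ {n | Ideal.map (algebraMap (𝓞 K) (𝓞 L)) (Ideal.span {p}) ≤ Q ^ n} := by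
    simp only [Set.mem_ofPred_eq, Ideal.map_span, Set.image_singleton]
    rwa [Ideal.span_singleton_le_iff_mem]
  unfold Ideal.ramificationIdx' at h
  by_cases hb : BddAbove {n | Ideal.map (algebraMap (𝓞 K) (𝓞 L)) (Ideal.span {p}) ≤ Q ^ n}
  · have := le_csSup hb hmem
    omega
  · rw [csSup_of_not_bddAbove hb] at h
    simp at h

/-- unramifiedness data at a prime element -/
theorem exists_over {K L : Type} [Field K] [NumberField K] [Field L] [Algebra K L]
    [NumberField L]
    (hun : ∀ P : Ideal (𝓞 K), P.IsPrime → P ≠ ⊥ → (3 : 𝓞 K) ∉ P →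
          ∀ Q : Ideal (𝓞 L), Q.IsPrime → Q.comap (algebraMap (𝓞 K) (𝓞 L)) = P →
            Ideal.ramificationIdx' P Q = 1)
    (p : 𝓞 K) (hp : Prime p) (h3 : ¬ p ∣ 3) :
    ∃ Q : Ideal (𝓞 L), Q.IsPrime ∧ Q ≠ ⊥ ∧ (∀ x, algebraMap (𝓞 K) (𝓞 L) x ∈ Q ↔ p ∣ x) ∧
      algebraMap (𝓞 K) (𝓞 L) p ∉ Q ^ 2 := by
  have hP : (Ideal.span {p}).IsPrime := (Ideal.span_singleton_prime hp.ne_zero).mpr hp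
  obtain ⟨Q, hQ, hQP⟩ := Ideal.exists_ideal_over_prime_of_isIntegral_of_isDomain (S := 𝓞 L)
    (Ideal.span {p}) (by
      rw [(RingHom.injective_iff_ker_eq_bot _).mp
        (FaithfulSMul.algebraMap_injective (𝓞 K) (𝓞 L))]; exact bot_le)
  have hiff : ∀ x, algebraMap (𝓞 K) (𝓞 L) x ∈ Q ↔ p ∣ x := by
    intro x
    rw [← Ideal.mem_span_singleton, ← hQP, Ideal.mem_comap]
  refine ⟨Q, hQ, ?_, hiff, ?_⟩
  · rintro rfl
    have := (hiff p).mpr dvd_rfl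
    rw [Ideal.mem_bot, map_eq_zero_iff _ (FaithfulSMul.algebraMap_injective (𝓞 K) (𝓞 L))] at this
    exact hp.ne_zero this
  · apply not_mem_sq_of_unram
    apply hun _ hP _ _ _ hQ hQP
    · simpa using hp.ne_zero
    · rwa [Ideal.mem_span_singleton]

theorem key (K L : Type) [Field K] [NumberField K] [Field L] [Algebra K L]
    [NumberField L] [IsPrincipalIdealRing (𝓞 K)] (hL : Module.finrank K L = 2)
    (hun : ∀ P : Ideal (𝓞 K), P.IsPrime → P ≠ ⊥ → (3 : 𝓞 K) ∉ P →
          ∀ Q : Ideal (𝓞 L), Q.IsPrime → Q.comap (algebraMap (𝓞 K) (𝓞 L)) = P →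
            Ideal.ramificationIdx' P Q = 1)
    (h2 : Prime (2 : 𝓞 K)) (π : 𝓞 K)
    (h3 : ∀ p : 𝓞 K, Prime p → p ∣ 3 → Associated p π) :
    ∃ (u : (𝓞 K)ˣ) (x : 𝓞 K), (x = u ∨ x = u * π) ∧ ¬ IsSquare x ∧
      ∃ b c, x = b ^ 2 + 4 * c := by
  obtain ⟨α, a, hα, ha⟩ := exists_sqrt_gen K L hL
  -- integral version
  have hex : ∃ x : 𝓞 K, ¬ IsSquare x ∧ ∃ β : 𝓞 L, β ^ 2 = algebraMap (𝓞 K) (𝓞 L) x := by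
    obtain ⟨n, d, hd, hnd⟩ := IsFractionRing.div_surjective (A := 𝓞 K) a
    have hd0 : algebraMap (𝓞 K) K d ≠ 0 := by
      simpa using nonZeroDivisors.ne_zero hd
    have hsq : (α * algebraMap K L (algebraMap (𝓞 K) K d)) ^ 2 =
        algebraMap K L (algebraMap (𝓞 K) K (n * d)) := by
      rw [mul_pow, hα, ← hnd, ← map_pow, ← map_mul]
      congr 1
      rw [map_mul]
      field_simp
    refine ⟨n * d, ?_, ⟨α * algebraMap K L (algebraMap (𝓞 K) K d), ?_⟩, ?_⟩
    · rintro ⟨r, hr⟩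
      apply ha
      refine ⟨algebraMap (𝓞 K) K r / algebraMap (𝓞 K) K d, ?_⟩
      rw [← hnd]
      have := congrArg (algebraMap (𝓞 K) K) hr
      rw [map_mul, map_mul] at this
      field_simp
      linear_combination this
    · apply IsIntegral.of_pow (n := 2) (by norm_num)
      rw [hsq]
      exact (RingOfIntegers.isIntegral_coe (n * d)).algebraMap
    · apply RingOfIntegers.ext
      exact hsq
  -- minimal choice
  obtain ⟨x, ⟨hx, β, hβ⟩, hmin⟩ := (wellFounded_dvdNotUnit (α := 𝓞 K)).has_min
    {x | ¬ IsSquare x ∧ ∃ β : 𝓞 L, β ^ 2 = algebraMap (𝓞 K) (𝓞 L) x} hex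
  have hx0 : x ≠ 0 := by rintro rfl; exact hx (by simp)
  have hsf : ∀ p y, Prime p → x ≠ p * p * y := by
    intro p y hp hxy
    refine hmin y ⟨?_, ?_⟩ ⟨?_, p * p, ?_, ?_⟩
    · rintro ⟨r, rfl⟩; exact hx ⟨p * r, by rw [hxy]; ring⟩
    · have hp0 : algebraMap (𝓞 K) (𝓞 L) p ≠ 0 := by
        rw [Ne, map_eq_zero_iff _ (FaithfulSMul.algebraMap_injective (𝓞 K) (𝓞 L))]
        exact hp.ne_zero
      have hdvd : (algebraMap (𝓞 K) (𝓞 L) p) ^ 2 ∣ β ^ 2 := by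
        rw [hβ, hxy]; exact ⟨algebraMap (𝓞 K) (𝓞 L) y, by simp only [map_mul]; ring⟩
      rw [IsIntegrallyClosed.pow_dvd_pow_iff (by norm_num)] at hdvd
      obtain ⟨γ, rfl⟩ := hdvd
      refine ⟨γ, ?_⟩
      apply mul_left_cancel₀ (pow_ne_zero 2 hp0)
      rw [← mul_pow, hβ, hxy]; simp only [map_mul]; ring
    · rintro rfl; apply hx0; rw [hxy]; simp
    · intro hu; exact hp.not_isUnit (isUnit_of_mul_isUnit_left hu)
    · rw [hxy]; ring
  have hdiv : ∀ p, Prime p → p ∣ x → Associated p π := by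
    intro p hp hpx
    apply h3 p hp
    by_contra hp3
    obtain ⟨Q, hQ, hQ0, hQi, hQ2⟩ := exists_over hun p hp hp3
    have hβQ : β ∈ Q := by
      apply hQ.mem_of_pow_mem 2
      rw [hβ]; exact (hQi x).mpr hpx
    obtain ⟨y, rfl⟩ := hpx
    have hy : algebraMap (𝓞 K) (𝓞 L) y ∈ Q := by
      apply Ideal.mem_prime_of_mul_mem_pow hQ0 (i := 1) hQ2
      rw [← map_mul, ← hβ]
      exact Ideal.pow_mem_pow hβQ 2
    obtain ⟨w, rfl⟩ := (hQi y).mp hy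
    exact hsf p w hp (by ring)
  have hform : ∃ u : (𝓞 K)ˣ, x = u ∨ x = u * π := by
    by_cases hxu : IsUnit x
    · exact ⟨hxu.unit, Or.inl rfl⟩
    · obtain ⟨p, hp, hpx⟩ := WfDvdMonoid.exists_irreducible_factor hxu hx0
      have hpp := hp.prime
      have hpa := hdiv p hpp hpx
      obtain ⟨y, hy⟩ := hpx
      have hyu : IsUnit y := by
        by_contra hyu
        obtain ⟨q, hq, hqy⟩ := WfDvdMonoid.exists_irreducible_factor hyu
          (by rintro rfl; apply hx0; simp [hy])
        have hqa := hdiv q hq.prime (hqy.trans ⟨p, by rw [hy]; ring⟩)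
        obtain ⟨w, hw⟩ := (hpa.trans hqa.symm).dvd.trans hqy
        exact hsf p w hpp (by rw [hy, hw]; ring)
      obtain ⟨v, hv⟩ := hpa.symm
      refine ⟨v * hyu.unit, Or.inr ?_⟩
      rw [hy, ← hv]; push_cast; rw [IsUnit.unit_spec]; ring
  obtain ⟨u, hu⟩ := hform
  refine ⟨u, x, hu, hx, ?_⟩
  have h23 : ¬ (2 : 𝓞 K) ∣ 3 := by
    intro h
    have : (2 : 𝓞 K) ∣ 1 := by
      have := dvd_sub h (dvd_refl (2 : 𝓞 K)); rwa [show (3 : 𝓞 K) - 2 = 1 by norm_num] at this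
    exact h2.not_isUnit (isUnit_iff_dvd_one.mpr this)
  obtain ⟨Q, hQ, hQ0, hQi, hQ2⟩ := exists_over hun 2 h2 h23
  -- x is a square mod 2
  have hsq2 : ∃ b c, x = b ^ 2 + 2 * c := by
    have hPr : (Ideal.span {(2 : 𝓞 K)}).IsPrime := (Ideal.span_singleton_prime h2.ne_zero).mpr h2
    have hP0 : Ideal.span {(2 : 𝓞 K)} ≠ ⊥ := by simpa using h2.ne_zero
    have hPm : (Ideal.span {(2 : 𝓞 K)}).IsMaximal := hPr.isMaximal hP0
    let _ : Field (𝓞 K ⧸ Ideal.span {(2 : 𝓞 K)}) := Ideal.Quotient.field _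
    have : Finite (𝓞 K ⧸ Ideal.span {(2 : 𝓞 K)}) := Ideal.finiteQuotientOfFreeOfNeBot _ hP0
    have hz : (2 : 𝓞 K ⧸ Ideal.span {(2 : 𝓞 K)}) = 0 := by
      rw [← map_ofNat (Ideal.Quotient.mk (Ideal.span {(2 : 𝓞 K)})) 2,
        Ideal.Quotient.eq_zero_iff_mem]
      exact Ideal.mem_span_singleton_self 2
    have : CharP (𝓞 K ⧸ Ideal.span {(2 : 𝓞 K)}) 2 := CharTwo.of_one_ne_zero_of_two_eq_zero one_ne_zero hz
    obtain ⟨r, hr⟩ := FiniteField.isSquare_of_char_two (ringChar.eq _ 2)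
      (Ideal.Quotient.mk (Ideal.span {(2 : 𝓞 K)}) x)
    obtain ⟨b, rfl⟩ := Ideal.Quotient.mk_surjective r
    rw [← map_mul, Ideal.Quotient.eq, Ideal.mem_span_singleton] at hr
    obtain ⟨c, hc⟩ := hr
    exact ⟨b, c, by linear_combination hc⟩
  obtain ⟨b, c, hbc⟩ := hsq2
  set f := algebraMap (𝓞 K) (𝓞 L) with hf
  have h2Q : (2 : 𝓞 L) ∈ Q := by
    have := (hQi 2).mpr dvd_rfl; rwa [map_ofNat] at this
  rw [map_ofNat] at hQ2
  have hγ : (β - f b) ^ 2 + 2 * (f b * (β - f b)) = 2 * f c := by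
    have : f x = f b ^ 2 + 2 * f c := by rw [hbc, map_add, map_pow, map_mul, map_ofNat]
    linear_combination hβ + this
  have hγQ : β - f b ∈ Q := by
    apply hQ.mem_of_pow_mem 2
    rw [show (β - f b) ^ 2 = 2 * (f c - f b * (β - f b)) by linear_combination hγ]
    exact Q.mul_mem_right _ h2Q
  have hcQ : f c ∈ Q := by
    apply Ideal.mem_prime_of_mul_mem_pow hQ0 (i := 1) hQ2
    rw [← hγ]
    refine Ideal.add_mem _ (Ideal.pow_mem_pow hγQ 2) ?_
    rw [show 1 + 1 = 2 from rfl, pow_two]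
    exact Ideal.mul_mem_mul h2Q (Q.mul_mem_left _ hγQ)
  obtain ⟨d, rfl⟩ := (hQi c).mp hcQ
  exact ⟨b, d, by rw [hbc]; ring⟩

theorem units_mod_sq (K : Type) [Field K] [NumberField K] {ι : Type} [Fintype ι]
    (S : ι → (𝓞 K)ˣ) (hc : Fintype.card ι = 2 ^ (Units.rank K + 1))
    (hS : ∀ i j, i ≠ j → ¬ IsSquare (S i * S j)) (u : (𝓞 K)ˣ) : ∃ i v, u = S i * v ^ 2 := by
  classical
  obtain ⟨g, hg⟩ := IsCyclic.exists_generator (α := Units.torsion K)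
  let pw : (𝓞 K)ˣ → Bool → (𝓞 K)ˣ := fun x b => if b then x else 1
  have hpw : ∀ (x : (𝓞 K)ˣ) (n : ℤ), ∃ b v, x ^ n = pw x b * v ^ 2 := by
    intro x n
    rcases Int.even_or_odd' n with ⟨m, rfl | rfl⟩
    · exact ⟨false, x ^ m, by
        rw [mul_comm 2 m, zpow_mul]; simp only [pw]; norm_cast; simp⟩
    · exact ⟨true, x ^ m, by
        rw [mul_comm 2 m, zpow_add, zpow_mul, zpow_one, mul_comm]; simp only [pw]; norm_cast⟩
  let T := Bool × (Fin (Units.rank K) → Bool)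
  let rep : T → (𝓞 K)ˣ := fun t => pw g t.1 * ∏ i, pw (Units.fundSystem K i) (t.2 i)
  have hrep : ∀ u : (𝓞 K)ˣ, ∃ t v, u = rep t * v ^ 2 := by
    intro u
    obtain ⟨⟨ζ, e⟩, he, -⟩ := Units.exist_unique_eq_mul_prod K u
    obtain ⟨n, hn⟩ := Subgroup.mem_zpowers_iff.mp (hg ζ)
    obtain ⟨b, v, hb⟩ := hpw g n
    choose c w hcw using fun i => hpw (Units.fundSystem K i) (e i)
    refine ⟨(b, c), v * ∏ i, w i, ?_⟩
    simp only [rep]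
    rw [he]
    simp only [← hn, Subgroup.coe_zpow, hb, hcw, Finset.prod_mul_distrib, mul_pow, Finset.prod_pow]
    exact mul_mul_mul_comm _ _ _ _
  choose t v htv using hrep
  have hinj : Function.Injective (fun i => t (S i)) := by
    intro i j hij
    by_contra hne
    apply hS i j hne
    refine ⟨rep (t (S i)) * (v (S i) * v (S j)), ?_⟩
    have hij' : t (S i) = t (S j) := hij
    calc S i * S j = (rep (t (S i)) * v (S i) ^ 2) * (rep (t (S j)) * v (S j) ^ 2) := by
          rw [← htv, ← htv]
      _ = _ := by
          rw [← hij', pow_two, pow_two]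
          simp only [mul_comm, mul_left_comm, mul_assoc]
  have hbij : Function.Bijective (fun i => t (S i)) := by
    rw [Fintype.bijective_iff_injective_and_card]
    refine ⟨hinj, ?_⟩
    rw [hc]
    simp [T, pow_succ, mul_comm]
  obtain ⟨i, hi⟩ := hbij.2 (t u)
  refine ⟨i, (v (S i))⁻¹ * v u, ?_⟩
  have hi' : t (S i) = t u := hi
  calc u = rep (t u) * v u ^ 2 := htv u
    _ = (rep (t (S i)) * v (S i) ^ 2) * ((v (S i))⁻¹ * v u) ^ 2 := by
        rw [hi', mul_pow, inv_pow]; group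
    _ = _ := by rw [← htv]


theorem lies_over_of_mem {K : Type} [Field K] [NumberField K] (P : Ideal (𝓞 K)) (hP : P.IsPrime)
    (p : ℕ) (hp : p.Prime) (h : (p : 𝓞 K) ∈ P) : P.LiesOver (Ideal.span {(p : ℤ)}) := by
  constructor
  have hm : (Ideal.span {(p : ℤ)}).IsMaximal :=
    PrincipalIdealRing.isMaximal_of_irreducible (Nat.prime_iff_prime_int.mp hp).irreducible
  apply hm.eq_of_le
  · exact (Ideal.IsPrime.under ℤ P).ne_top
  · rw [Ideal.span_singleton_le_iff_mem, Ideal.mem_comap]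
    simpa using h

theorem two_prime {K : Type} [Field K] [NumberField K] (n : ℕ) [NeZero n]
    [IsCyclotomicExtension {n} ℚ K]
    (hn : ¬ 2 ∣ n) (ho : orderOf ((2 : ℕ) : ZMod n) = n.totient) : Prime (2 : 𝓞 K) := by
  have hnu : ¬ IsUnit (2 : 𝓞 K) := by
    intro hu
    have h1 := Ideal.span_singleton_eq_top.mpr hu
    have h2 := Ideal.absNorm_span_singleton (2 : 𝓞 K)
    rw [h1, Ideal.absNorm_top] at h2
    have h3 := Algebra.norm_algebraMap (S := 𝓞 K) (2 : ℤ)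
    rw [map_ofNat] at h3
    rw [h3, Int.natAbs_pow] at h2
    have h4 : Module.finrank ℤ (𝓞 K) ≠ 0 := Module.finrank_pos.ne'
    have := Nat.one_lt_two_pow h4
    simp at h2
    omega
  obtain ⟨P, hPm, hle⟩ := Ideal.exists_le_maximal (Ideal.span {(2 : 𝓞 K)})
    (by rwa [Ne, Ideal.span_singleton_eq_top])
  have hP := hPm.isPrime
  have h2P : (2 : 𝓞 K) ∈ P := hle (Ideal.mem_span_singleton_self 2)
  have : P.LiesOver (Ideal.span {((2 : ℕ) : ℤ)}) :=
    lies_over_of_mem P hP 2 Nat.prime_two (by simpa using h2P)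
  have : Fact (Nat.Prime 2) := ⟨Nat.prime_two⟩
  have hin := IsCyclotomicExtension.Rat.inertiaDeg_eq_of_not_dvd (p := 2) (K := K) (m := n) (P := P) hn
  have hnorm := Ideal.absNorm_eq_pow_inertiaDeg' P Nat.prime_two
  rw [Ideal.inertiaDeg'_eq_inertiaDeg, hin, ho] at hnorm
  have hN2 : Ideal.absNorm (Ideal.span {(2 : 𝓞 K)}) = 2 ^ n.totient := by
    rw [Ideal.absNorm_span_singleton]
    have h3 := Algebra.norm_algebraMap (S := 𝓞 K) (2 : ℤ)
    rw [map_ofNat] at h3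
    rw [h3, RingOfIntegers.rank, IsCyclotomicExtension.finrank (n := n) K
      (Polynomial.cyclotomic.irreducible_rat (NeZero.pos n)), Int.natAbs_pow]
    rfl
  have heq : Ideal.span {(2 : 𝓞 K)} = P := by
    obtain ⟨J, hJ⟩ := Ideal.dvd_iff_le.mpr hle
    have hmul := congrArg Ideal.absNorm hJ
    rw [map_mul, hN2, hnorm] at hmul
    have hJ1 : Ideal.absNorm J = 1 := by
      have : 0 < 2 ^ n.totient := by positivity
      exact (Nat.eq_of_mul_eq_mul_left this (by rw [mul_one]; exact hmul)).symm
    rw [Ideal.absNorm_eq_one_iff] at hJ1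
    rw [hJ, hJ1, Ideal.mul_top]
  rw [← Ideal.span_singleton_prime two_ne_zero, heq]
  exact hP

theorem three_ass {K : Type} [Field K] [NumberField K] (k : ℕ) [IsCyclotomicExtension {3 ^ (k+1)} ℚ K]
    {ζ : K} (hζ : IsPrimitiveRoot ζ (3 ^ (k+1))) (p : 𝓞 K) (hp : Prime p) (h3 : p ∣ 3) :
    Associated p (hζ.toInteger - 1) := by
  have hP : (Ideal.span {p}).IsPrime := (Ideal.span_singleton_prime hp.ne_zero).mpr hp
  have : (Ideal.span {p}).LiesOver (Ideal.span {((3 : ℕ) : ℤ)}) :=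
    lies_over_of_mem _ hP 3 Nat.prime_three (by
      rw [Ideal.mem_span_singleton]; simpa using h3)
  have : Fact (Nat.Prime 3) := ⟨Nat.prime_three⟩
  have := IsCyclotomicExtension.Rat.eq_span_zeta_sub_one_of_liesOver 3 k K hζ (Ideal.span {p})
  rwa [Ideal.span_singleton_eq_span_singleton] at this

theorem pid9 (K : Type) [Field K] [NumberField K] [IsCyclotomicExtension {9} ℚ K] :
    IsPrincipalIdealRing (𝓞 K) := by
  have : Fact (Nat.Prime 3) := ⟨Nat.prime_three⟩
  have hcyc : IsCyclotomicExtension {3 ^ (1+1)} ℚ K := by norm_num; infer_instance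
  have hd := IsCyclotomicExtension.Rat.discr_prime_pow_succ 3 1 K
  norm_num at hd
  have hf : Module.finrank ℚ K = 6 := by
    rw [IsCyclotomicExtension.finrank (n := 9) K
      (Polynomial.cyclotomic.irreducible_rat (by norm_num))]; decide
  have hc : InfinitePlace.nrComplexPlaces K = 3 := by
    rw [IsCyclotomicExtension.Rat.nrComplexPlaces_eq_totient_div_two 9]; decide
  refine RingOfIntegers.isPrincipalIdealRing_of_isPrincipal_of_pow_le_of_mem_primesOver_of_mem_Icc ?_
  rw [hd, hf, hc]
  intro p hp hpp P hP hple
  have hb : ⌊(4 / Real.pi) ^ 3 * (((Nat.factorial 6 : ℕ) : ℝ) / ((6 : ℕ) : ℝ) ^ 6 * √|((-19683 : ℤ) : ℝ)|)⌋₊ ≤ 5 := by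
    have h1 : (4 / Real.pi) ≤ 4 / 3 := by
      gcongr; exact Real.pi_gt_three.le
    have h2 : √|((-19683 : ℤ) : ℝ)| ≤ 141 := by
      rw [Real.sqrt_le_left (by norm_num)]; norm_num
    have h3 : (4 / Real.pi) ^ 3 ≤ (4/3)^3 := by gcongr
    refine Nat.le_of_lt_succ ((Nat.floor_lt (by positivity)).mpr ?_)
    calc _ ≤ (4 / 3 : ℝ) ^ 3 * (((Nat.factorial 6 : ℕ) : ℝ) / ((6 : ℕ) : ℝ) ^ 6 * 141) := by gcongr
      _ < _ := by norm_num [Nat.factorial]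
  have hple' := hple.trans hb
  have hp5 : p ≤ 5 := (Finset.mem_Icc.mp hp).2.trans hb
  obtain ⟨hP1, hP2⟩ := hP
  have hin : ∀ (hn : ¬ p ∣ 9), P.inertiaDeg ℤ = orderOf ((p : ℕ) : ZMod 9) := by
    intro hn
    have : Fact p.Prime := ⟨hpp⟩
    exact IsCyclotomicExtension.Rat.inertiaDeg_eq_of_not_dvd (p := p) (K := K) (m := 9) (P := P) hn
  have ord : ∀ p : ℕ, (p : ZMod 9) ^ 1 ≠ 1 → (p : ZMod 9) ^ 2 ≠ 1 → (p : ZMod 9) ^ 6 = 1 →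
     3 ≤ orderOf ((p : ℕ) : ZMod 9) := by
    intro p h1 h2 h6
    by_contra hlt
    have h0 : 0 < orderOf ((p : ℕ) : ZMod 9) := orderOf_pos_iff.mpr (isOfFinOrder_iff_pow_eq_one.mpr ⟨6, by norm_num, h6⟩)
    have hpw := pow_orderOf_eq_one ((p : ℕ) : ZMod 9)
    have : orderOf ((p : ℕ) : ZMod 9) = 1 ∨ orderOf ((p : ℕ) : ZMod 9) = 2 := by omega
    rcases this with h | h <;> rw [h] at hpw
    · exact h1 hpw
    · exact h2 hpw
  have big : ¬ p ∣ 9 → 3 ≤ orderOf ((p : ℕ) : ZMod 9) → False := by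
    intro hn h3
    rw [hin hn] at hple'
    have h1 : 2 ^ 3 ≤ p ^ 3 := Nat.pow_le_pow_left hpp.two_le 3
    have h2 : p ^ 3 ≤ p ^ orderOf ((p : ℕ) : ZMod 9) := Nat.pow_le_pow_right hpp.pos h3
    omega
  by_cases hp3 : p = 3
  · subst hp3
    have hζ : IsPrimitiveRoot (IsCyclotomicExtension.zeta (3^(1+1)) ℚ K) (3^(1+1)) := IsCyclotomicExtension.zeta_spec _ ℚ K
    rw [IsCyclotomicExtension.Rat.eq_span_zeta_sub_one_of_liesOver 3 1 K hζ P]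
    exact ⟨_, rfl⟩
  · exfalso
    interval_cases p
    · exact absurd hpp (by norm_num)
    · exact absurd hpp (by norm_num)
    · exact big (by norm_num) (ord 2 (by decide) (by decide) (by decide))
    · exact hp3 rfl
    · exact absurd hpp (by norm_num)
    · exact big (by norm_num) (ord 5 (by decide) (by decide) (by decide))

theorem rank_eq (K : Type) [Field K] [NumberField K] (n : ℕ) [NeZero n] [IsCyclotomicExtension {n} ℚ K]
    (hn : 2 < n) : Units.rank K = n.totient / 2 - 1 := by
  rw [Units.rank, InfinitePlace.card_eq_nrRealPlaces_add_nrComplexPlaces,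
    IsCyclotomicExtension.Rat.nrRealPlaces_eq_zero (n := n) K hn,
    IsCyclotomicExtension.Rat.nrComplexPlaces_eq_totient_div_two n, zero_add]

namespace RR

theorem test_pair : ∀ b0 b1 b2 b3 b4 b5 : Bool, ∀ i j : Bool × Bool × Bool,
    (⟨bit b0, bit b1, bit b2, bit b3, bit b4, bit b5⟩ *
      ⟨bit b0, bit b1, bit b2, bit b3, bit b4, bit b5⟩ : RR) =
      el i.1 i.2.1 i.2.2 false * el j.1 j.2.1 j.2.2 false → i = j := by decide +kernel

theorem test_pi : ∀ b0 b1 b2 b3 b4 b5 : Bool, ∀ i : Bool × Bool × Bool,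
    (⟨bit b0, bit b1, bit b2, bit b3, bit b4, bit b5⟩ *
      ⟨bit b0, bit b1, bit b2, bit b3, bit b4, bit b5⟩ : RR) ≠
      el i.1 i.2.1 i.2.2 false * (z - 1) := by decide +kernel

theorem test3_pair : ∀ b0 b1 b2 b3 b4 b5 : Bool, ∀ i j : Bool,
    (⟨bit b0, bit b1, bit b2, bit b3, bit b4, bit b5⟩ *
      ⟨bit b0, bit b1, bit b2, bit b3, bit b4, bit b5⟩ : RR) =
      pw (-1) i * pw (-1) j → i = j := by decide +kernel

theorem test3_pi : ∀ b0 b1 b2 b3 b4 b5 : Bool, ∀ i : Bool,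
    (⟨bit b0, bit b1, bit b2, bit b3, bit b4, bit b5⟩ *
      ⟨bit b0, bit b1, bit b2, bit b3, bit b4, bit b5⟩ : RR) ≠
      pw (-1) i * (z ^ 3 - 1) := by decide +kernel

theorem z_root3 : (z ^ 3) ^ 2 + z ^ 3 + 1 = 0 := by decide +kernel

end RR

theorem final (K L : Type) [Field K] [NumberField K] [Field L] [Algebra K L]
    [NumberField L] [IsPrincipalIdealRing (𝓞 K)] (hL : Module.finrank K L = 2)
    (hun : ∀ P : Ideal (𝓞 K), P.IsPrime → P ≠ ⊥ → (3 : 𝓞 K) ∉ P →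
          ∀ Q : Ideal (𝓞 L), Q.IsPrime → Q.comap (algebraMap (𝓞 K) (𝓞 L)) = P →
            Ideal.ramificationIdx' P Q = 1)
    (h2 : Prime (2 : 𝓞 K)) (π : 𝓞 K)
    (h3 : ∀ p : 𝓞 K, Prime p → p ∣ 3 → Associated p π)
    {ι : Type} [Fintype ι] (S : ι → (𝓞 K)ˣ) (hc : Fintype.card ι = 2 ^ (Units.rank K + 1))
    (i0 : ι) (hi0 : S i0 = 1) (φ : 𝓞 K →+* RR)
    (hS : ∀ i j (b : RR), b * b = φ (S i) * φ (S j) → i = j)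
    (hSπ : ∀ i (b : RR), b * b ≠ φ (S i) * φ π) : False := by
  obtain ⟨u, x, hx, hns, b, c, hbc⟩ := key K L hL hun h2 π h3
  obtain ⟨i, v, hv⟩ := units_mod_sq K S hc (by
    rintro i j hij ⟨r, hr⟩
    apply hij
    apply hS i j (φ r)
    rw [← map_mul, ← map_mul, ← Units.val_mul, ← Units.val_mul, hr]) u
  have hφx : φ x = φ b * φ b := by
    rw [hbc, map_add, map_mul, map_ofNat, RR.four]; simp [pow_two]
  have hvinv : φ (v : 𝓞 K) * φ ((v⁻¹ : (𝓞 K)ˣ) : 𝓞 K) = 1 := by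
    rw [← map_mul, Units.mul_inv, map_one]
  have hφu : φ u = φ (S i) * φ v ^ 2 := by
    rw [hv]; simp
  set w := φ ((v⁻¹ : (𝓞 K)ˣ) : 𝓞 K)
  rcases hx with hx | hx
  · have : i = i0 := by
      apply hS i i0 (φ b * w)
      rw [hi0, Units.val_one, map_one]
      rw [hx, hφu] at hφx
      linear_combination -w ^ 2 * hφx + φ (S i) * (φ v * w + 1) * hvinv
    apply hns
    refine ⟨v, ?_⟩
    rw [hx, hv, this, hi0]; simp [pow_two]
  · apply hSπ i (φ b * w)
    rw [hx, map_mul, hφu] at hφx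
    linear_combination -w ^ 2 * hφx + φ (S i) * φ π * (φ v * w + 1) * hvinv

theorem exists_hom {K : Type} [Field K] [NumberField K] (k : ℕ)
    [IsCyclotomicExtension {3 ^ (k+1)} ℚ K] {ζ : K} (hζ : IsPrimitiveRoot ζ (3 ^ (k+1)))
    (r : RR) (hr : (r ^ 3 ^ k) ^ 2 + r ^ 3 ^ k + 1 = 0) :
    ∃ φ : 𝓞 K →+* RR, φ hζ.toInteger = r := by
  have hmin : minpoly ℤ hζ.integralPowerBasis.gen = Polynomial.cyclotomic (3 ^ (k + 1)) ℤ := by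
    rw [IsPrimitiveRoot.integralPowerBasis_gen, ← RingOfIntegers.minpoly_coe,
      Polynomial.cyclotomic_eq_minpoly hζ (by positivity)]
    rfl
  have h0 : Polynomial.aeval r (minpoly ℤ hζ.integralPowerBasis.gen) = 0 := by
    rw [hmin, Polynomial.cyclotomic_prime_pow_eq_geom_sum Nat.prime_three]
    simp only [Finset.sum_range_succ, Finset.sum_range_zero, map_add, map_pow, Polynomial.aeval_X,
      pow_zero, map_one, map_zero, zero_add, pow_one]
    linear_combination hr
  refine ⟨(hζ.integralPowerBasis.lift r h0 : 𝓞 K →ₐ[ℤ] RR), ?_⟩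
  have := hζ.integralPowerBasis.lift_gen r h0
  rw [IsPrimitiveRoot.integralPowerBasis_gen] at this
  exact this

theorem case9 (K : Type) [Field K] [NumberField K] [IsCyclotomicExtension ({9} : Set ℕ) ℚ K]
    (L : Type) [Field L] [Algebra K L] [NumberField L] (hL : Module.finrank K L = 2)
    (hun : ∀ P : Ideal (𝓞 K), P.IsPrime → P ≠ ⊥ → (3 : 𝓞 K) ∉ P →
          ∀ Q : Ideal (𝓞 L), Q.IsPrime → Q.comap (algebraMap (𝓞 K) (𝓞 L)) = P →
            Ideal.ramificationIdx' P Q = 1) : False := by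
  have := pid9 K
  have hcyc : IsCyclotomicExtension {3 ^ (1+1)} ℚ K := by norm_num; infer_instance
  have hζ : IsPrimitiveRoot (IsCyclotomicExtension.zeta (3^(1+1)) ℚ K) (3^(1+1)) :=
    IsCyclotomicExtension.zeta_spec _ ℚ K
  obtain ⟨φ, hφ⟩ := exists_hom 1 hζ RR.z (by decide +kernel)
  set t := hζ.toInteger with ht
  have hroot : t ^ 6 + t ^ 3 + 1 = 0 := by
    have h1 : IsPrimitiveRoot t 9 := hζ.toInteger_isPrimitiveRoot
    have h9 := h1.pow_eq_one
    have h3 : t ^ 3 - 1 ≠ 0 := by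
      intro h
      have := (h1.pow_eq_one_iff_dvd 3).mp (by linear_combination h)
      norm_num at this
    apply mul_left_cancel₀ h3
    linear_combination h9
  let u1 : (𝓞 K)ˣ := Units.mkOfMulEqOne (1 + t) (-(t ^ 3 * (t ^ 2 - t + 1))) (by
    linear_combination -hroot)
  let u2 : (𝓞 K)ˣ := Units.mkOfMulEqOne (1 + t * t) (-(t ^ 6 * (t ^ 4 - t ^ 2 + 1))) (by
    linear_combination -(t ^ 6 - t ^ 3 + 1) * hroot)
  let pw : (𝓞 K)ˣ → Bool → (𝓞 K)ˣ := fun x b => if b then x else 1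
  have hpw : ∀ x b, φ (pw x b : (𝓞 K)ˣ) = RR.pw (φ x) b := by
    intro x b; cases b <;> simp [pw, RR.pw]
  have e1 : φ (u1 : 𝓞 K) = 1 + RR.z := by
    change φ (1 + t) = _
    rw [map_add, map_one, hφ]
  have e2 : φ (u2 : 𝓞 K) = 1 + RR.z * RR.z := by
    change φ (1 + t * t) = _
    rw [map_add, map_one, map_mul, hφ]
  let S : Bool × Bool × Bool → (𝓞 K)ˣ := fun i => pw (-1) i.1 * pw u1 i.2.1 * pw u2 i.2.2
  have hS : ∀ i, φ (S i : 𝓞 K) = RR.el i.1 i.2.1 i.2.2 false := by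
    intro i
    simp only [S, Units.val_mul, map_mul, hpw, e1, e2, RR.el]
    simp [RR.pw]
  refine final K L hL hun (two_prime 9 (by norm_num) ?_) (t - 1) (three_ass 1 hζ) S ?_
    (false, false, false) ?_ φ ?_ ?_
  · rw [show Nat.totient 9 = 6 by decide, orderOf_eq_iff (by norm_num)]
    refine ⟨by decide, ?_⟩
    intro m hm hm0
    interval_cases m <;> decide
  · rw [rank_eq K 9 (by norm_num), show Nat.totient 9 = 6 by decide]; simp
  · simp [S, pw]
  · intro i j b hb
    obtain ⟨b0, b1, b2, b3, b4, b5, h⟩ := RR.sq_eq b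
    rw [h, hS, hS] at hb
    exact RR.test_pair b0 b1 b2 b3 b4 b5 i j hb
  · intro i b hb
    obtain ⟨b0, b1, b2, b3, b4, b5, h⟩ := RR.sq_eq b
    rw [h, hS, map_sub, map_one, hφ] at hb
    exact RR.test_pi b0 b1 b2 b3 b4 b5 i hb

theorem cyc3 (K : Type) [Field K] [NumberField K] (s : K) (hs : s ^ 2 = -3)
    (hK : Module.finrank ℚ K = 2) : IsCyclotomicExtension ({3} : Set ℕ) ℚ K := by
  have hprim : IsPrimitiveRoot ((-1 + s) / 2) 3 := by
    have : Fact (Nat.Prime 3) := ⟨Nat.prime_three⟩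
    refine IsPrimitiveRoot.of_map_of_injective (f := RingHom.id K) ?_ (fun _ _ h => h)
    rw [IsPrimitiveRoot.iff_orderOf]
    apply orderOf_eq_prime
    · simp only [RingHom.id_apply]
      linear_combination ((s - 3) / 8) * hs
    · simp only [RingHom.id_apply]
      intro h
      have h3 : s = 3 := by linear_combination 2 * h
      rw [h3] at hs
      norm_num at hs
  rw [IsCyclotomicExtension.iff_singleton]
  refine ⟨⟨_, hprim⟩, ?_⟩
  have := Subalgebra.isSimpleOrder_of_finrank hK
  intro x
  rcases eq_bot_or_eq_top (Algebra.adjoin ℚ {b : K | b ^ 3 = 1}) with h | h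
  · exfalso
    have hmem : (-1 + s) / 2 ∈ Algebra.adjoin ℚ {b : K | b ^ 3 = 1} :=
      Algebra.subset_adjoin hprim.pow_eq_one
    rw [h, Algebra.mem_bot] at hmem
    obtain ⟨q, hq⟩ := hmem
    have hsq : s = algebraMap ℚ K (2 * q + 1) := by
      rw [map_add, map_mul, hq, map_ofNat, map_one]; ring
    have : (2 * q + 1) ^ 2 = -3 := by
      apply (algebraMap ℚ K).injective
      rw [map_pow, ← hsq, hs]; simp
    nlinarith [sq_nonneg (2 * q + 1)]
  · rw [h]; trivial

theorem case3 (K : Type) [Field K] [NumberField K] [IsCyclotomicExtension ({3} : Set ℕ) ℚ K]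
    (L : Type) [Field L] [Algebra K L] [NumberField L] (hL : Module.finrank K L = 2)
    (hun : ∀ P : Ideal (𝓞 K), P.IsPrime → P ≠ ⊥ → (3 : 𝓞 K) ∉ P →
          ∀ Q : Ideal (𝓞 L), Q.IsPrime → Q.comap (algebraMap (𝓞 K) (𝓞 L)) = P →
            Ideal.ramificationIdx' P Q = 1) : False := by
  have := IsCyclotomicExtension.Rat.three_pid K
  have hcyc : IsCyclotomicExtension {3 ^ (0+1)} ℚ K := by norm_num; infer_instance
  have hζ : IsPrimitiveRoot (IsCyclotomicExtension.zeta (3^(0+1)) ℚ K) (3^(0+1)) :=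
    IsCyclotomicExtension.zeta_spec _ ℚ K
  obtain ⟨φ, hφ⟩ := exists_hom 0 hζ (RR.z ^ 3) (by decide +kernel)
  set t := hζ.toInteger with ht
  let S : Bool → (𝓞 K)ˣ := fun b => if b then -1 else 1
  have hS : ∀ i, φ (S i : 𝓞 K) = RR.pw (-1) i := by
    intro i; cases i <;> simp [S, RR.pw]
  refine final K L hL hun (two_prime 3 (by norm_num) ?_) (t - 1) (three_ass 0 hζ) S ?_
    false ?_ φ ?_ ?_
  · rw [show Nat.totient 3 = 2 by decide, orderOf_eq_iff (by norm_num)]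
    refine ⟨by decide, ?_⟩
    intro m hm hm0
    interval_cases m; decide
  · rw [rank_eq K 3 (by norm_num), show Nat.totient 3 = 2 by decide]; simp
  · simp [S]
  · intro i j b hb
    obtain ⟨b0, b1, b2, b3, b4, b5, h⟩ := RR.sq_eq b
    rw [h, hS, hS] at hb
    exact RR.test3_pair b0 b1 b2 b3 b4 b5 i j hb
  · intro i b hb
    obtain ⟨b0, b1, b2, b3, b4, b5, h⟩ := RR.sq_eq b
    rw [h, hS, map_sub, map_one, hφ] at hb
    exact RR.test3_pi b0 b1 b2 b3 b4 b5 i hb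



/-- Neither `ℚ(√-3)` nor the 9th cyclotomic field `ℚ(ζ₉)` possesses a quadratic extension
unramified at every prime of its ring of integers not dividing `3`. -/
theorem no_quadratic_extension_unramified_outside_three :
    (∀ (K : Type) [Field K] [NumberField K] (s : K), s ^ 2 = -3 →
      Module.finrank ℚ K = 2 →
      ∀ (L : Type) [Field L] [Algebra K L] [NumberField L], Module.finrank K L = 2 →
        (∀ P : Ideal (𝓞 K), P.IsPrime → P ≠ ⊥ → (3 : 𝓞 K) ∉ P →
          ∀ Q : Ideal (𝓞 L), Q.IsPrime → Q.comap (algebraMap (𝓞 K) (𝓞 L)) = P →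
            Ideal.ramificationIdx' P Q = 1) →
        False) ∧
    (∀ (K : Type) [Field K] [NumberField K] [IsCyclotomicExtension ({9} : Set ℕ) ℚ K],
      ∀ (L : Type) [Field L] [Algebra K L] [NumberField L], Module.finrank K L = 2 →
        (∀ P : Ideal (𝓞 K), P.IsPrime → P ≠ ⊥ → (3 : 𝓞 K) ∉ P →
          ∀ Q : Ideal (𝓞 L), Q.IsPrime → Q.comap (algebraMap (𝓞 K) (𝓞 L)) = P →
            Ideal.ramificationIdx' P Q = 1) →
        False) := by
  refine ⟨?_, ?_⟩
  · intro K _ _ s hs hK L _ _ _ hL hun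
    have := cyc3 K s hs hK
    exact case3 K L hL hun
  · intro K _ _ _ L _ _ _ hL hun
    exact case9 K L hL hun
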